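/- arXiv:2206.00413 — 3 statements merged into one kernel-verified Lean document; each statement's English description precedes it below -/
import Mathlib

section
/- Let k ≥ 2 be an integer and, for each i ∈ {1,…,k}, let a_i and m_i be integers with m_i ≥ 1 and gcd(a_i, m_i) = 1, and let P_{m_i} := {p prime : p ≡ a_i (mod m_i)}. Then D^k(P_{m_1},…,P_{m_k}) is dense in S^{k-1}. -/
open Set Filter Topology

noncomputable def rho {k : ℕ} (u : Fin k → ℝ) : EuclideanSpace ℝ (Fin k) :=
  ‖((EuclideanSpace.equiv (Fin k) ℝ).symm u : EuclideanSpace ℝ (Fin k))‖⁻¹ •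
    ((EuclideanSpace.equiv (Fin k) ℝ).symm u)

def unitSphere (k : ℕ) : Set (EuclideanSpace ℝ (Fin k)) :=
  {x | ‖x‖ = 1 ∧ ∀ i, x i ∈ Icc (0:ℝ) 1}

def genDir (k : ℕ) (U : Fin k → Set ℕ) : Set (EuclideanSpace ℝ (Fin k)) :=
  {y | ∃ u : Fin k → ℕ, (∀ i, u i ∈ U i) ∧ y = rho (fun i => (u i : ℝ))}

def genDirDistinct (k : ℕ) (U : Fin k → Set ℕ) : Set (EuclideanSpace ℝ (Fin k)) :=
  {y | ∃ u : Fin k → ℕ, (∀ i, u i ∈ U i) ∧ (∀ i j, i ≠ j → u i ≠ u j) ∧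
    y = rho (fun i => (u i : ℝ))}

def dirSet (k : ℕ) (A : Set ℕ) : Set (EuclideanSpace ℝ (Fin k)) :=
  {y | ∃ u : Fin k → ℕ, (∀ i, u i ∈ A) ∧ y = rho (fun i => (u i : ℝ))}

def accSet {α : Type*} [TopologicalSpace α] (Y : Set α) : Set α := {x | AccPt x (𝓟 Y)}


section kern
open MeasureTheory FourierTransform Convolution Complex
open scoped ContDiff

lemma kern_base : ∃ (g h : ℝ → ℂ) (u : ℝ → ℝ), Continuous g ∧ HasCompactSupport g ∧
    Continuous h ∧ HasCompactSupport h ∧ Continuous u ∧ Integrable (fun x => u x ^ 2) ∧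
    Integrable (fun x => (x * u x) ^ 2) ∧ (∀ x, 𝓕 g x = (u x : ℂ)) ∧
    (∀ x, 𝓕 h x = 2 * Real.pi * I * x * (u x : ℂ)) ∧ u 0 ≠ 0 := by
  let b : ContDiffBump (0:ℝ) := ⟨1, 2, by norm_num, by norm_num⟩
  let g : ℝ → ℂ := fun x => (b x : ℂ)
  have hgs : ContDiff ℝ ∞ g := Complex.ofRealCLM.contDiff.comp b.contDiff
  have hgc : HasCompactSupport g := b.hasCompactSupport.comp_left (g := ((↑) : ℝ → ℂ)) (by simp)
  let G : SchwartzMap ℝ ℂ := hgc.toSchwartzMap hgs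
  let H : SchwartzMap ℝ ℂ := SchwartzMap.derivCLM ℂ ℂ G
  have hGg : (G : ℝ → ℂ) = g := by ext x; rfl
  have hHg : (H : ℝ → ℂ) = deriv g := by ext x; rw [SchwartzMap.derivCLM_apply, hGg]
  let u : ℝ → ℝ := fun x => (𝓕 g x).re
  have hFG : ∀ x, (𝓕 G) x = 𝓕 g x := by intro x; rw [SchwartzMap.fourier_coe, hGg]
  have hFH : ∀ x, (𝓕 H) x = 𝓕 (deriv g) x := by intro x; rw [SchwartzMap.fourier_coe, hHg]
  have hu : ∀ x, 𝓕 g x = (u x : ℂ) := by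
    intro x
    symm
    apply Complex.conj_eq_iff_re.1
    rw [Real.fourier_real_eq_integral_exp_smul, ← integral_conj, ← integral_neg_eq_self]
    congr 1
    ext v
    have : b (-v) = b v := b.neg v
    simp only [smul_eq_mul, map_mul, g, this, Complex.conj_ofReal, ← Complex.exp_conj, Complex.conj_I]
    congr 2
    push_cast
    ring
  have hd : ∀ x, 𝓕 (deriv g) x = 2 * Real.pi * I * x * (u x : ℂ) := by
    intro x
    rw [Real.fourier_deriv (by rw [← hGg]; exact G.integrable) (hgs.differentiable (by simp))
      (by rw [← hHg]; exact H.integrable), ← hu]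
    rfl
  refine ⟨g, deriv g, u, hgs.continuous, hgc, ?_, hgc.deriv, ?_, ?_, ?_, hu, hd, ?_⟩
  · rw [← hHg]; exact H.continuous
  · have : Continuous (fun x => (𝓕 G) x) := (𝓕 G).continuous
    have h2 : u = fun x => ((𝓕 G) x).re := by ext x; rw [hFG]
    rw [h2]; fun_prop
  · have := ((𝓕 G).memLp 2).norm.integrable_sq
    refine this.congr (ae_of_all _ fun x => ?_)
    simp only [hFG, hu]
    simp
  · have := ((𝓕 H).memLp 2).norm.integrable_sq.const_mul ((2 * Real.pi) ^ 2)⁻¹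
    refine this.congr (ae_of_all _ fun x => ?_)
    have := Real.pi_pos
    simp only [hFH, hd]
    simp only [norm_mul, Complex.norm_real, Complex.norm_I, mul_pow, Real.norm_eq_abs, sq_abs]
    simp
    field_simp
  · have : 𝓕 g 0 = ((∫ x, b x : ℝ) : ℂ) := by
      rw [Real.fourier_real_eq_integral_exp_smul]
      simp only [mul_zero, Complex.ofReal_zero, zero_mul, Complex.exp_zero, one_smul, g]
      exact integral_ofReal
    have h3 : u 0 = ∫ x, b x := by
      simp only [u, this, Complex.ofReal_re]
    rw [h3]
    exact b.integral_pos.ne'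

lemma kern (δ : ℝ) (hδ : 0 < δ) : ∃ (ψ : ℝ → ℂ) (f : ℝ → ℝ), Continuous ψ ∧ HasCompactSupport ψ ∧
    Integrable f ∧ (∀ x, 𝓕 ψ x = (f x : ℂ)) ∧ (∀ x, δ ≤ |x| → f x ≤ 0) ∧ 0 < ∫ x, f x := by
  obtain ⟨g, h, u, gc, gs, hc, hs, uc, i1, i2, fg, fh, u0⟩ := kern_base
  set A := ∫ x, u x ^ 2 with hA
  set B := ∫ x, (x * u x) ^ 2 with hB
  have hApos : 0 < A := integral_pos_of_integrable_nonneg_nonzero (x := 0) (by fun_prop) i1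
    (fun x => sq_nonneg _) (by positivity)
  have hBnn : 0 ≤ B := integral_nonneg (fun x => sq_nonneg _)
  obtain ⟨R, hR, hRB⟩ : ∃ R : ℝ, 0 < R ∧ B / R ^ 2 < A := by
    refine ⟨B / A + 1, by positivity, ?_⟩
    rw [div_lt_iff₀ (by positivity)]
    have : A * (B / A + 1) ^ 2 = B ^ 2 / A + 2 * B + A := by field_simp; ring
    rw [this]
    have : 0 ≤ B ^ 2 / A := by positivity
    linarith
  set L := ContinuousLinearMap.mul ℂ ℂ with hL
  let c : ℂ := (4 * Real.pi ^ 2 * R ^ 2)⁻¹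
  have gi := gc.integrable_of_hasCompactSupport (μ := volume) gs
  have hi := hc.integrable_of_hasCompactSupport (μ := volume) hs
  let ψ₀ : ℝ → ℂ := fun y => (g ⋆[L] g) y + c * (h ⋆[L] h) y
  have c1 : Continuous (g ⋆[L] g) := gs.continuous_convolution_right L gi.locallyIntegrable gc
  have c2 : Continuous (h ⋆[L] h) := hs.continuous_convolution_right L hi.locallyIntegrable hc
  have s1 : HasCompactSupport (g ⋆[L] g) := gs.convolution L gs
  have s2 : HasCompactSupport (h ⋆[L] h) := hs.convolution L hs
  have hψc : Continuous ψ₀ := by fun_prop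
  have hψs : HasCompactSupport ψ₀ := s1.add (s2.mul_left (f := fun _ => c))
  let f₀ : ℝ → ℝ := fun x => u x ^ 2 - (R ^ 2)⁻¹ * (x * u x) ^ 2
  have hf0 : ∀ x, 𝓕 ψ₀ x = (f₀ x : ℂ) := by
    intro x
    have e1 : 𝓕 ψ₀ x = 𝓕 (g ⋆[L] g) x + c * 𝓕 (h ⋆[L] h) x := by
      simp only [Real.fourier_real_eq, ψ₀, smul_add]
      rw [integral_add, ← integral_const_mul]
      · congr 2; ext v; simp only [Circle.smul_def, smul_eq_mul]; ring
      · exact (Real.fourierIntegral_convergent_iff x).2 (c1.integrable_of_hasCompactSupport s1) |>.congr (ae_of_all _ fun v => by simp [mul_comm])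
      · exact (Real.fourierIntegral_convergent_iff x).2 ((c2.integrable_of_hasCompactSupport s2).const_mul c) |>.congr (ae_of_all _ fun v => by simp [mul_comm])
    rw [e1, Real.fourier_mul_convolution_eq gi gi, Real.fourier_mul_convolution_eq hi hi, fg, fh]
    have hp : (Real.pi : ℂ) ≠ 0 := by exact_mod_cast Real.pi_ne_zero
    have hr : (R : ℂ) ≠ 0 := by exact_mod_cast hR.ne'
    simp only [f₀, c]
    push_cast
    field_simp
    linear_combination (x:ℂ)^2 * (u x : ℂ)^2 * 4 * I_sq
  let b := R / δ
  have hb : 0 < b := by positivity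
  refine ⟨fun y => (b⁻¹ : ℝ) * ψ₀ (b⁻¹ * y), fun x => f₀ (b * x), by fun_prop, ?_, ?_, ?_, ?_, ?_⟩
  · exact (hψs.comp_homeomorph (Homeomorph.mulLeft₀ b⁻¹ (by positivity))).mul_left (f := fun _ => ((b⁻¹ : ℝ) : ℂ))
  · exact (i1.sub (i2.const_mul _)).comp_mul_left' hb.ne'
  · intro x
    rw [← hf0]
    simp only [Real.fourier_real_eq_integral_exp_smul]
    have := Measure.integral_comp_mul_left (fun v => cexp (↑(-2 * Real.pi * v * (b * x)) * I) • ψ₀ v) b⁻¹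
    rw [inv_inv, abs_of_pos hb] at this
    have e : ∀ z : ℂ, z = (b⁻¹ : ℝ) • (b • z) := by
      intro z; rw [smul_smul, inv_mul_cancel₀ hb.ne', one_smul]
    rw [e (∫ v, cexp (↑(-2 * Real.pi * v * (b * x)) * I) • ψ₀ v), ← this, ← integral_smul]
    congr 1
    ext v
    have : -2 * Real.pi * (b⁻¹ * v) * (b * x) = -2 * Real.pi * v * x := by field_simp
    rw [this]
    simp
    ring
  · intro x hx
    have : R ≤ |b * x| := by
      rw [abs_mul, abs_of_pos hb]
      calc R = b * δ := by simp only [b]; field_simp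
        _ ≤ _ := by gcongr
    have h2 : R ^ 2 ≤ (b * x) ^ 2 := by
      rw [← sq_abs (b * x)]; gcongr
    have h3 : 1 ≤ (R ^ 2)⁻¹ * (b * x) ^ 2 := by
      rw [← div_eq_inv_mul, le_div_iff₀ (by positivity)]; linarith
    simp only [f₀, mul_pow _ (u _)]
    nlinarith [sq_nonneg (u (b * x))]
  · rw [Measure.integral_comp_mul_left f₀ b, integral_sub i1 (i2.const_mul _), integral_const_mul, smul_eq_mul]
    have : 0 < A - (R ^ 2)⁻¹ * B := by rw [← div_eq_inv_mul]; linarith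
    positivity
end kern

section main
open MeasureTheory FourierTransform Complex ArithmeticFunction.vonMangoldt

lemma stepA {q : ℕ} [NeZero q] (a : ZMod q) (ψ : ℝ → ℂ) (hc : Continuous ψ)
    (hs : HasCompactSupport ψ) (η : ℝ) (hη : 0 < η) :
    HasSum (fun n : ℕ => ((residueClass a n / (n:ℝ) ^ (1 + η) : ℝ) : ℂ) * 𝓕 ψ (Real.log n))
      (∫ y : ℝ, ψ y * LSeries (fun n => (residueClass a n : ℂ)) (1 + η + 2 * Real.pi * I * y)) := by
  have hsum : Summable fun n : ℕ => residueClass a n / (n:ℝ) ^ (1 + η) := by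
    have h := LSeriesSummable_of_abscissaOfAbsConv_lt_re (s := ((1 + η : ℝ) : ℂ)) <|
      (abscissaOfAbsConv_residueClass_le_one a).trans_lt (by rw [Complex.ofReal_re]; exact_mod_cast (by linarith : (1:ℝ) < 1 + η))
    have h2 := h.norm
    refine h2.congr fun n => ?_
    rw [LSeries.norm_term_eq]
    split_ifs with h0
    · simp [h0]
    · rw [Complex.norm_real, Real.norm_of_nonneg (residueClass_nonneg a n), Complex.ofReal_re]
  have hterm : ∀ (n : ℕ) (y : ℝ), LSeries.term (fun n => (residueClass a n : ℂ)) (1 + η + 2 * Real.pi * I * y) n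
      = ((residueClass a n / (n:ℝ) ^ (1 + η) : ℝ) : ℂ) * cexp (↑(-2 * Real.pi * y * Real.log n) * I) := by
    intro n y
    rcases eq_or_ne n 0 with rfl | h0
    · simp
    · have hn : (0:ℝ) < n := by positivity
      have hn' : (n : ℂ) ≠ 0 := by exact_mod_cast h0
      rw [LSeries.term_of_ne_zero h0, Complex.ofReal_div, div_eq_mul_inv, div_eq_mul_inv,
        mul_assoc ((residueClass a n : ℝ) : ℂ)]
      refine congrArg (((residueClass a n : ℝ) : ℂ) * ·) ?_
      rw [Complex.cpow_add _ _ hn', mul_inv, Complex.ofReal_cpow hn.le]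
      congr 1
      · simp
      · rw [Complex.cpow_def_of_ne_zero hn', ← Complex.exp_neg, ← Complex.ofReal_natCast, ← Complex.ofReal_log hn.le]
        congr 1
        push_cast; ring
  have hψi := hc.integrable_of_hasCompactSupport (μ := volume) hs
  have hnorm : ∀ (n : ℕ) (y : ℝ), ‖ψ y * LSeries.term (fun n => (residueClass a n : ℂ)) (1 + η + 2 * Real.pi * I * y) n‖
      = ‖ψ y‖ * (residueClass a n / (n:ℝ) ^ (1 + η)) := by
    intro n y
    rw [hterm, norm_mul, norm_mul, Complex.norm_exp_ofReal_mul_I, Complex.norm_real, mul_one,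
      Real.norm_of_nonneg (div_nonneg (residueClass_nonneg a n) (by positivity))]
  have key := hasSum_integral_of_summable_integral_norm (μ := volume)
    (F := fun (n : ℕ) (y : ℝ) => ψ y * LSeries.term (fun n => (residueClass a n : ℂ)) (1 + η + 2 * Real.pi * I * y) n)
    (by
      intro n
      apply Continuous.integrable_of_hasCompactSupport
      · simp only [hterm]; fun_prop
      · exact hs.mul_right)
    (by
      simp only [hnorm, integral_mul_const]
      exact hsum.mul_left _)
  convert! key using 1
  · ext n
    simp only [hterm, Real.fourier_real_eq_integral_exp_smul, smul_eq_mul]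
    rw [← integral_const_mul]
    congr 1
    ext y
    ring
  · simp only [LSeries, tsum_mul_left]

lemma stepB (ψ : ℝ → ℂ) (hc : Continuous ψ)
    (hs : HasCompactSupport ψ) (η : ℝ) (hη : 0 < η) :
    ∫ y : ℝ, ψ y * (1 / (η + 2 * Real.pi * I * y)) =
      ∫ u in Ioi (0:ℝ), (Real.exp (-η * u) : ℂ) * 𝓕 ψ u := by
  have hψi := hc.integrable_of_hasCompactSupport (μ := volume) hs
  have h1 : ∀ y : ℝ, ψ y * (1 / (η + 2 * Real.pi * I * y)) =
      ∫ u in Ioi (0:ℝ), ψ y * cexp (-(η + 2 * Real.pi * I * y) * u) := by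
    intro y
    rw [integral_const_mul, integral_exp_mul_complex_Ioi (by simpa using hη)]
    simp only [Complex.ofReal_zero, mul_zero, Complex.exp_zero, neg_div_neg_eq]
  simp only [h1]
  rw [integral_integral_swap]
  · refine integral_congr_ae (ae_of_all _ fun u => ?_)
    simp only [Real.fourier_real_eq_integral_exp_smul, smul_eq_mul]
    rw [← integral_const_mul]
    congr 1
    ext y
    rw [mul_comm (ψ y), ← mul_assoc, Complex.ofReal_exp, ← Complex.exp_add]
    congr 2
    push_cast; ring
  · have hi2 : Integrable (fun u : ℝ => Real.exp (-η * u)) (volume.restrict (Ioi 0)) :=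
      exp_neg_integrableOn_Ioi 0 hη
    refine (hψi.norm.mul_prod hi2).mono ?_ (ae_of_all _ fun z => ?_)
    · apply Continuous.aestronglyMeasurable
      simp only [Function.uncurry_def]
      fun_prop
    · simp [Function.uncurry_def, Complex.norm_exp]

lemma stepC {q : ℕ} [NeZero q] (a : ZMod q) (ha : IsUnit a) (ψ : ℝ → ℂ) (hc : Continuous ψ)
    (hs : HasCompactSupport ψ) (η : ℝ) (hη : 0 < η) :
    HasSum (fun n : ℕ => ((residueClass a n / (n:ℝ) ^ (1 + η) : ℝ) : ℂ) * 𝓕 ψ (Real.log n))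
      ((q.totient : ℂ)⁻¹ * (∫ u in Ioi (0:ℝ), (Real.exp (-η * u) : ℂ) * 𝓕 ψ u) +
        ∫ y : ℝ, ψ y * LFunctionResidueClassAux a (1 + η + 2 * Real.pi * I * y)) := by
  convert! stepA a ψ hc hs η hη using 1
  rw [← stepB ψ hc hs η hη, ← integral_const_mul, ← integral_add]
  · congr 1
    ext y
    rw [eqOn_LFunctionResidueClassAux ha (x := 1 + η + 2 * Real.pi * I * y) (by simp [hη])]
    have : (1 + η + 2 * Real.pi * I * y - 1 : ℂ) = η + 2 * Real.pi * I * y := by ring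
    simp only [this]
    ring
  · apply Continuous.integrable_of_hasCompactSupport
    · refine continuous_const.mul (hc.mul (continuous_const.div (by fun_prop) fun y h => ?_))
      have := congrArg Complex.re h
      simp at this
      linarith
    · exact (hs.mul_right).mul_left (f := fun _ => (q.totient : ℂ)⁻¹)
  · apply Continuous.integrable_of_hasCompactSupport
    · refine hc.mul ?_
      refine (continuousOn_LFunctionResidueClassAux a).comp_continuous (by fun_prop) fun y => ?_
      simp [hη.le]
    · exact hs.mul_right

lemma stepE {q : ℕ} [NeZero q] (a : ZMod q) (ψ : ℝ → ℂ) (hc : Continuous ψ)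
    (hs : HasCompactSupport ψ) :
    Tendsto (fun η : ℝ => ∫ y : ℝ, ψ y * LFunctionResidueClassAux a (1 + η + 2 * Real.pi * I * y))
      (𝓝[>] 0) (𝓝 (∫ y : ℝ, ψ y * LFunctionResidueClassAux a (1 + 2 * Real.pi * I * y))) := by
  have := continuousOn_integral_of_compact_support (μ := volume) (s := Ici (0:ℝ)) (k := tsupport ψ)
    (f := fun (η : ℝ) (y : ℝ) => ψ y * LFunctionResidueClassAux a (1 + η + 2 * Real.pi * I * y)) hs
    (by
      refine (hc.comp continuous_snd).continuousOn.mul ?_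
      refine (continuousOn_LFunctionResidueClassAux a).comp (by fun_prop) ?_
      rintro ⟨x, y⟩ ⟨hx, -⟩
      simpa using hx)
    (by
      intro p x _ hx
      simp [image_eq_zero_of_notMem_tsupport hx])
  have h2 := (this 0 (by simp)).mono_left (nhdsWithin_mono _ Ioi_subset_Ici_self)
  simpa using h2

lemma fourier_shift (ψ : ℝ → ℂ) (t x : ℝ) :
    𝓕 (fun y : ℝ => cexp (↑(2 * Real.pi * y * t) * I) * ψ y) x = 𝓕 ψ (x - t) := by
  simp only [Real.fourier_real_eq_integral_exp_smul, smul_eq_mul]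
  congr 1
  ext y
  rw [← mul_assoc, ← Complex.exp_add]
  congr 2
  push_cast; ring

lemma stepF (f : ℝ → ℝ) (hf : Integrable f) (t : ℝ) :
    Tendsto (fun η : ℝ => ∫ u in Ioi (0:ℝ), Real.exp (-η * u) * f (u - t))
      (𝓝[>] 0) (𝓝 (∫ u in Ioi (0:ℝ), f (u - t))) := by
  have hft : Integrable (fun u => f (u - t)) := hf.comp_sub_right t
  apply tendsto_integral_filter_of_dominated_convergence (fun u => ‖f (u - t)‖)
  · refine Eventually.of_forall fun η => ?_
    exact (Continuous.aestronglyMeasurable (by fun_prop)).mul hft.1.restrict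
  · filter_upwards [self_mem_nhdsWithin] with η hη
    filter_upwards [ae_restrict_mem measurableSet_Ioi] with u hu
    rw [norm_mul, Real.norm_of_nonneg (Real.exp_pos _).le]
    refine mul_le_of_le_one_left (norm_nonneg _) (Real.exp_le_one_iff.2 ?_)
    have : 0 < η * u := mul_pos hη hu
    linarith
  · exact hft.norm.restrict
  · refine ae_of_all _ fun u => ?_
    have : Continuous fun η : ℝ => Real.exp (-η * u) * f (u - t) := by fun_prop
    simpa using (this.tendsto 0).mono_left nhdsWithin_le_nhds

lemma stepG (f : ℝ → ℝ) (hf : Integrable f) :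
    Tendsto (fun t : ℝ => ∫ u in Ioi (0:ℝ), f (u - t)) atTop (𝓝 (∫ u, f u)) := by
  have h1 : ∀ t : ℝ, ∫ u in Ioi (0:ℝ), f (u - t) = ∫ u in Ioi (-t), f u := by
    intro t
    rw [← integral_indicator measurableSet_Ioi, ← integral_indicator measurableSet_Ioi,
      ← integral_sub_right_eq_self ((Ioi (-t)).indicator f) t]
    congr 1
    ext u
    have : -t < u - t ↔ 0 < u := by constructor <;> intro h <;> linarith
    simp only [indicator, mem_Ioi, this]
  simp only [h1]
  exact (aecover_Ioi tendsto_neg_atTop_atBot).integral_tendsto_of_countably_generated hf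

lemma stepT (w : ℕ → ℝ) (hw : ∀ n, 0 ≤ w n) (hsum : Summable w) (δ : ℝ) :
    Tendsto (fun t : ℝ => ∑' n : ℕ, if |Real.log n - t| < δ then w n else 0) atTop (𝓝 0) := by
  have := tendsto_tsum_of_dominated_convergence 
    (f := fun (t : ℝ) (n : ℕ) => if |Real.log n - t| < δ then w n else 0) (g := fun _ => (0:ℝ))
    hsum (by
      intro n
      apply tendsto_const_nhds.congr'
      filter_upwards [eventually_ge_atTop (Real.log n + δ)] with t ht
      rw [if_neg]
      rw [not_lt]
      calc δ ≤ -(Real.log n - t) := by linarith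
        _ ≤ _ := neg_le_abs _)
    (Eventually.of_forall fun t n => by
      split_ifs
      · rw [Real.norm_of_nonneg (hw n)]
      · simpa using hw n)
  simpa using this

lemma gap {q : ℕ} [NeZero q] (a : ZMod q) (ha : IsUnit a) (δ : ℝ) (hδ : 0 < δ) :
    ∀ᶠ t : ℝ in atTop, ∃ p : ℕ, p.Prime ∧ (p : ZMod q) = a ∧ |Real.log p - t| < δ := by
  obtain ⟨ψ, f, hc, hs, hfi, hF, hneg, hpos⟩ := kern δ hδ
  set C := ∫ y, ‖ψ y‖ with hC
  have hC0 : 0 ≤ C := integral_nonneg fun _ => norm_nonneg _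
  have hfC : ∀ x, f x ≤ C := by
    intro x
    have := VectorFourier.norm_fourierIntegral_le_integral_norm Real.fourierChar volume (innerₗ ℝ) ψ x
    calc f x ≤ ‖(f x : ℂ)‖ := by rw [Complex.norm_real]; exact le_abs_self _
      _ ≤ C := by rw [← hF]; exact this
  let w : ℕ → ℝ := fun n => (if n.Prime then 0 else residueClass a n) / n
  have hw0 : ∀ n, 0 ≤ w n := fun n => by
    have := residueClass_nonneg a n
    simp only [w]; split_ifs <;> positivity
  have hwsum : Summable w := summable_residueClass_non_primes_div a
  let T : ℝ → ℝ := fun t => ∑' n : ℕ, if |Real.log n - t| < δ then w n else 0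
  have hT : Tendsto T atTop (𝓝 0) := stepT w hw0 hwsum δ
  let ψt : ℝ → ℝ → ℂ := fun t y => cexp (↑(2 * Real.pi * y * t) * I) * ψ y
  let E : ℝ → ℂ := fun t => ∫ y : ℝ, ψt t y * LFunctionResidueClassAux a (1 + 2 * Real.pi * I * y)
  have hE : Tendsto E atTop (𝓝 0) := by
    have h1 := (Real.zero_at_infty_fourier (fun y : ℝ => ψ y * LFunctionResidueClassAux a (1 + 2 * Real.pi * I * y))).mono_left atBot_le_cocompact
    have h2 := h1.comp tendsto_neg_atTop_atBot
    refine h2.congr fun t => ?_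
    simp only [Function.comp, Real.fourier_real_eq_integral_exp_smul, smul_eq_mul, E, ψt]
    congr 1
    ext y
    rw [← mul_assoc]
    congr 4
    push_cast
    ring
  set c : ℝ := (q.totient : ℝ)⁻¹ with hcdef
  have hcpos : 0 < c := by
    have := Nat.totient_pos.mpr (NeZero.pos q)
    positivity
  have hlim : Tendsto (fun t => c * (∫ u in Ioi (0:ℝ), f (u - t)) + (E t).re - C * T t) atTop
      (𝓝 (c * (∫ u, f u) + 0 - C * 0)) := by
    refine (((stepG f hfi).const_mul c).add ?_).sub (hT.const_mul C)
    exact (Complex.continuous_re.tendsto 0).comp hE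
  have hev := hlim.eventually (lt_mem_nhds (a := 0) (by simp; positivity))
  filter_upwards [hev] with t ht
  by_contra hno
  push Not at hno
  suffices c * (∫ u in Ioi (0:ℝ), f (u - t)) + (E t).re ≤ C * T t by linarith
  have hψc : Continuous (ψt t) := by fun_prop
  have hψs : HasCompactSupport (ψt t) := hs.mul_left
  have hFt : ∀ x, 𝓕 (ψt t) x = (f (x - t) : ℂ) := fun x => by rw [fourier_shift, hF]
  have hTsum : Summable fun n : ℕ => if |Real.log n - t| < δ then w n else 0 := by
    refine hwsum.of_nonneg_of_le (fun n => ?_) fun n => ?_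
    · split_ifs
      exacts [hw0 n, le_rfl]
    · split_ifs
      exacts [le_rfl, hw0 n]
  have hbound : ∀ η : ℝ, 0 < η → c * (∫ u in Ioi (0:ℝ), Real.exp (-η * u) * f (u - t)) +
      (∫ y : ℝ, ψt t y * LFunctionResidueClassAux a (1 + η + 2 * Real.pi * I * y)).re ≤ C * T t := by
    intro η hη
    have h := Complex.hasSum_re (stepC a ha (ψt t) hψc hψs η hη)
    have e1 : (∫ u in Ioi (0:ℝ), (Real.exp (-η * u) : ℂ) * 𝓕 (ψt t) u) =
        ((∫ u in Ioi (0:ℝ), Real.exp (-η * u) * f (u - t) : ℝ) : ℂ) := by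
      rw [← integral_complex_ofReal]
      simp only [hFt, Complex.ofReal_mul]
    rw [e1, Complex.add_re, ← Complex.ofReal_natCast, ← Complex.ofReal_inv, ← Complex.ofReal_mul,
      Complex.ofReal_re] at h
    refine hasSum_le (fun n => ?_) h (hTsum.hasSum.mul_left C)
    rw [hFt, ← Complex.ofReal_mul, Complex.ofReal_re]
    have hr := residueClass_nonneg a n
    rcases eq_or_ne n 0 with rfl | hn0
    · simp [w]
    have hn1 : (1:ℝ) ≤ n := by exact_mod_cast Nat.one_le_iff_ne_zero.2 hn0
    have hd0 : 0 ≤ residueClass a n / (n:ℝ) ^ (1 + η) := by positivity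
    by_cases hwin : |Real.log n - t| < δ
    · rw [if_pos hwin]
      by_cases hp : n.Prime
      · have hna : (n : ZMod q) ≠ a := fun h => absurd hwin (not_lt.2 (hno n hp h))
        have : residueClass a n = 0 := indicator_of_notMem (s := {n : ℕ | (n : ZMod q) = a}) hna _
        rw [this]; simp [w, hp]
      · have hle : residueClass a n / (n:ℝ) ^ (1 + η) ≤ w n := by
          simp only [w, if_neg hp]
          gcongr
          calc (n:ℝ) = (n:ℝ) ^ (1:ℝ) := (Real.rpow_one _).symm
            _ ≤ _ := Real.rpow_le_rpow_of_exponent_le hn1 (by linarith)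
        calc _ ≤ residueClass a n / (n:ℝ) ^ (1 + η) * C := by gcongr; exact hfC _
          _ ≤ w n * C := by gcongr
          _ = _ := mul_comm _ _
    · rw [if_neg hwin, mul_zero]
      exact mul_nonpos_of_nonneg_of_nonpos hd0 (hneg _ (not_lt.1 hwin))
  have hl := ((stepF f hfi t).const_mul c).add
    ((Complex.continuous_re.tendsto _).comp (stepE a (ψt t) hψc hψs))
  refine le_of_tendsto hl ?_
  filter_upwards [self_mem_nhdsWithin] with η hη
  exact hbound η hη
end main

lemma gap_int (a m : ℤ) (hm : 1 ≤ m) (h : Int.gcd a m = 1) (v : ℝ) (hv : 0 < v) (ε : ℝ) (hε : 0 < ε) :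
    ∀ᶠ t : ℝ in atTop, ∃ p : ℕ, (p.Prime ∧ (p : ℤ) ≡ a [ZMOD m]) ∧ |(p : ℝ) / Real.exp t - v| < ε := by
  lift m to ℕ using by omega
  have : NeZero m := ⟨by omega⟩
  have hu : IsUnit (a : ZMod m) := by
    rw [ZMod.coe_int_isUnit_iff_isCoprime, isCoprime_comm, Int.isCoprime_iff_gcd_eq_one]
    exact h
  have hcont := Real.continuous_exp.tendsto (Real.log v)
  rw [Real.exp_log hv] at hcont
  obtain ⟨δ, hδ, hd⟩ := Metric.tendsto_nhds_nhds.1 hcont ε hε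
  have h1 := gap (a : ZMod m) hu δ hδ
  have h2 := (tendsto_atTop_add_const_right atTop (Real.log v) tendsto_id).eventually h1
  filter_upwards [h2] with t ⟨p, hp, hpa, hpl⟩
  refine ⟨p, ⟨hp, ?_⟩, ?_⟩
  · rw [← ZMod.intCast_eq_intCast_iff]; simpa using hpa
  · have hp0 : (0:ℝ) < p := by exact_mod_cast hp.pos
    have := hd (x := Real.log p - t) (by
      rw [Real.dist_eq]
      simp only [id] at hpl
      rwa [show Real.log p - t - Real.log v = Real.log p - (t + Real.log v) by ring])
    rwa [Real.exp_sub, Real.exp_log hp0, Real.dist_eq] at this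

lemma rho_contAt {k : ℕ} (v : Fin k → ℝ) (hv : v ≠ 0) : ContinuousAt (rho (k := k)) v := by
  unfold rho
  have h : Continuous fun u : Fin k → ℝ => (EuclideanSpace.equiv (Fin k) ℝ).symm u :=
    (EuclideanSpace.equiv (Fin k) ℝ).symm.continuous
  refine ContinuousAt.smul (ContinuousAt.inv₀ h.norm.continuousAt ?_) h.continuousAt
  simpa using hv

lemma rho_smul {k : ℕ} (v : Fin k → ℝ) (c : ℝ) (hc : 0 < c) : rho (c • v) = rho v := by
  unfold rho
  rw [map_smul, norm_smul, Real.norm_of_nonneg hc.le, smul_smul]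
  congr 1
  field_simp

lemma pos_mem (k : ℕ) (a m : Fin k → ℤ)
    (hm : ∀ i, 1 ≤ m i) (hgcd : ∀ i, Int.gcd (a i) (m i) = 1) (v : Fin k → ℝ) (hv : ∀ i, 0 < v i)
    (hv0 : v ≠ 0) :
    rho v ∈ closure (genDir k (fun i => {p : ℕ | p.Prime ∧ (p : ℤ) ≡ a i [ZMOD m i]})) := by
  let S : Set (Fin k → ℝ) := {w | rho w ∈ genDir k (fun i => {p : ℕ | p.Prime ∧ (p : ℤ) ≡ a i [ZMOD m i]})}
  have hS : v ∈ closure S := by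
    rw [Metric.mem_closure_iff]
    intro ε hε
    have h1 : ∀ᶠ t : ℝ in atTop, ∀ i, ∃ p : ℕ, (p.Prime ∧ (p : ℤ) ≡ a i [ZMOD m i]) ∧
        |(p : ℝ) / Real.exp t - v i| < ε :=
      eventually_all.2 fun i => gap_int (a i) (m i) (hm i) (hgcd i) (v i) (hv i) ε hε
    obtain ⟨t, ht⟩ := h1.exists
    choose u hu1 hu2 using ht
    refine ⟨(Real.exp t)⁻¹ • fun i => (u i : ℝ), ⟨u, hu1, rho_smul _ _ (by positivity)⟩, ?_⟩
    rw [dist_comm, dist_pi_lt_iff hε]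
    intro i
    rw [Real.dist_eq]
    simpa [div_eq_inv_mul] using hu2 i
  exact (rho_contAt v hv0).continuousWithinAt.mem_closure hS fun w hw => hw


/-- For arithmetic progressions a_i mod m_i with gcd(a_i, m_i) = 1, the
k-generalized direction set of the corresponding sets of primes is dense in S^{k-1}. -/
theorem stmt_5 (k : ℕ) (hk : 2 ≤ k) (a m : Fin k → ℤ)
    (hm : ∀ i, 1 ≤ m i) (hgcd : ∀ i, Int.gcd (a i) (m i) = 1) :
    unitSphere k ⊆
      closure (genDir k (fun i => {p : ℕ | p.Prime ∧ (p : ℤ) ≡ a i [ZMOD m i]})) := by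
  rintro x ⟨hx1, hx2⟩
  let v : Fin k → ℝ := fun i => x i
  have hvx : (EuclideanSpace.equiv (Fin k) ℝ).symm v = x := by
    ext i; rfl
  have hrx : rho v = x := by
    unfold rho
    rw [hvx, hx1]; simp
  have hv0 : v ≠ 0 := by
    intro h
    rw [h] at hvx
    rw [← hvx] at hx1
    simp at hx1
  have i0 : Fin k := ⟨0, by omega⟩
  have hlim : Tendsto (fun ε : ℝ => rho (fun i => v i + ε)) (𝓝[>] 0) (𝓝 x) := by
    have h1 : Tendsto (fun (ε : ℝ) => (fun i => v i + ε : Fin k → ℝ)) (𝓝[>] 0) (𝓝 v) := by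
      have : Continuous fun (ε : ℝ) => (fun i => v i + ε : Fin k → ℝ) := by fun_prop
      simpa using (this.tendsto 0).mono_left nhdsWithin_le_nhds
    have := (rho_contAt v hv0).tendsto.comp h1
    rwa [hrx] at this
  refine isClosed_closure.mem_of_tendsto hlim ?_
  filter_upwards [self_mem_nhdsWithin] with ε hε
  have hp : ∀ i, 0 < v i + ε := fun i => add_pos_of_nonneg_of_pos (hx2 i).1 hε
  exact pos_mem k a m hm hgcd _ hp fun h => (hp i0).ne' (congrFun h i0)
end

section
/- Let A := ⋃_{j≥0} [5^j, 2·5^j) ∩ ℕ, B := ⋃_{j≥0} [2·5^j, 3·5^j) ∩ ℕ, and C := ⋃_{j≥0} [3·5^j, 5·5^j) ∩ ℕ. Then A, B, C are pairwise disjoint with A ∪ B ∪ C = ℕ, and for every integer k ≥ 3, none of D^k(A), D^k(B), D^k(C) is dense in S^{k-1}. -/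
open Set Filter Topology

lemma pow5_cases (i j : ℕ) : 5 ^ i ≤ 5 ^ j ∨ 5 * 5 ^ j ≤ 5 ^ i := by
  rcases le_or_gt i j with h | h
  · exact Or.inl (Nat.pow_le_pow_right (by norm_num) h)
  · right
    calc 5 * 5 ^ j = 5 ^ (j + 1) := by ring
      _ ≤ 5 ^ i := Nat.pow_le_pow_right (by norm_num) h

lemma pow5_tri (i j : ℕ) : 5 ^ i = 5 ^ j ∨ 5 * 5 ^ j ≤ 5 ^ i ∨ 5 * 5 ^ i ≤ 5 ^ j := by
  rcases pow5_cases i j with h | h <;> rcases pow5_cases j i with h' | h' <;> omega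

lemma rho_apply' {k : ℕ} (u : Fin k → ℝ) (i : Fin k) :
    rho u i = ‖((EuclideanSpace.equiv (Fin k) ℝ).symm u : EuclideanSpace ℝ (Fin k))‖⁻¹ * u i := by
  simp [rho]

lemma not_dense_aux (S : Set ℕ) (hS : ∀ a ∈ S, ∀ b ∈ S, ¬ (2 * b < a ∧ 2 * a < 5 * b))
    (k : ℕ) (hk : 3 ≤ k) : ¬ (unitSphere k ⊆ closure (dirSet k S)) := by
  intro h
  let i0 : Fin k := ⟨0, by omega⟩
  let i1 : Fin k := ⟨1, by omega⟩
  let w : Fin k → ℝ := fun i => if i = i0 then 9 else 4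
  have hw0 : w i0 = 9 := by simp [w]
  have hw1 : w i1 = 4 := by simp [w, i0, i1]
  have hwpos : ∀ i, 0 ≤ w i := by intro i; dsimp [w]; split_ifs <;> norm_num
  let v : EuclideanSpace ℝ (Fin k) := (EuclideanSpace.equiv (Fin k) ℝ).symm w
  have hv : v ≠ 0 := by
    intro hv
    have : v i0 = 0 := by rw [hv]; rfl
    have h2 : v i0 = w i0 := rfl
    rw [h2, hw0] at this
    norm_num at this
  have hc : 0 < ‖v‖⁻¹ := inv_pos.mpr (norm_pos_iff.mpr hv)
  have hn : ‖rho w‖ = 1 := by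
    change ‖‖v‖⁻¹ • v‖ = 1
    rw [norm_smul, norm_inv, norm_norm]
    exact inv_mul_cancel₀ (norm_ne_zero_iff.mpr hv)
  have hmem : rho w ∈ unitSphere k := by
    refine ⟨hn, fun i => ⟨?_, ?_⟩⟩
    · rw [rho_apply']
      exact mul_nonneg hc.le (hwpos i)
    · have := PiLp.norm_apply_le (rho w) i
      rw [hn] at this
      exact (le_abs_self _).trans this
  let O : Set (EuclideanSpace ℝ (Fin k)) := {x | 2 * x i1 < x i0 ∧ 2 * x i0 < 5 * x i1}
  have hO : IsOpen O := by
    apply IsOpen.and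
    · exact isOpen_lt (by fun_prop) (by fun_prop)
    · exact isOpen_lt (by fun_prop) (by fun_prop)
  have hwO : rho w ∈ O := by
    change 2 * rho w i1 < rho w i0 ∧ 2 * rho w i0 < 5 * rho w i1
    rw [rho_apply', rho_apply', hw0, hw1]
    change 0 < ‖v‖⁻¹ at hc
    constructor <;> nlinarith [hc]
  obtain ⟨y, hyO, u, hu, rfl⟩ := mem_closure_iff.mp (h hmem) O hO hwO
  change 2 * rho _ i1 < rho _ i0 ∧ 2 * rho _ i0 < 5 * rho _ i1 at hyO
  rw [rho_apply', rho_apply'] at hyO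
  obtain ⟨h1, h2⟩ := hyO
  set c := ‖((EuclideanSpace.equiv (Fin k) ℝ).symm (fun i => (u i : ℝ)) :
    EuclideanSpace ℝ (Fin k))‖⁻¹ with hcdef
  have hc0 : 0 ≤ c := inv_nonneg.mpr (norm_nonneg _)
  refine hS _ (hu i0) _ (hu i1) ⟨?_, ?_⟩
  · have : (2 * u i1 : ℝ) < u i0 := lt_of_mul_lt_mul_left (by linarith) hc0
    exact_mod_cast this
  · have : (2 * u i0 : ℝ) < 5 * u i1 := lt_of_mul_lt_mul_left (by linarith) hc0
    exact_mod_cast this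

/-- The explicit sets A = ⋃ⱼ [5^j, 2·5^j) ∩ ℕ, B = ⋃ⱼ [2·5^j, 3·5^j) ∩ ℕ,
C = ⋃ⱼ [3·5^j, 5·5^j) ∩ ℕ are pairwise disjoint, partition the positive integers, and
for every k ≥ 3 none of D^k(A), D^k(B), D^k(C) is dense in S^{k-1}. -/
theorem stmt_8 (A B C : Set ℕ)
    (hA : A = {n : ℕ | ∃ j : ℕ, 5 ^ j ≤ n ∧ n < 2 * 5 ^ j})
    (hB : B = {n : ℕ | ∃ j : ℕ, 2 * 5 ^ j ≤ n ∧ n < 3 * 5 ^ j})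
    (hC : C = {n : ℕ | ∃ j : ℕ, 3 * 5 ^ j ≤ n ∧ n < 5 * 5 ^ j}) :
    Disjoint A B ∧ Disjoint B C ∧ Disjoint A C ∧
      A ∪ B ∪ C = {n : ℕ | 0 < n} ∧
      ∀ k : ℕ, 3 ≤ k →
        ¬ (unitSphere k ⊆ closure (dirSet k A)) ∧
        ¬ (unitSphere k ⊆ closure (dirSet k B)) ∧
        ¬ (unitSphere k ⊆ closure (dirSet k C)) := by
  subst hA hB hC
  refine ⟨?_, ?_, ?_, ?_, fun k hk => ⟨?_, ?_, ?_⟩⟩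
  · rw [Set.disjoint_left]
    rintro n ⟨i, h1, h2⟩ ⟨j, h3, h4⟩
    rcases pow5_tri i j with h | h | h <;> omega
  · rw [Set.disjoint_left]
    rintro n ⟨i, h1, h2⟩ ⟨j, h3, h4⟩
    rcases pow5_tri i j with h | h | h <;> omega
  · rw [Set.disjoint_left]
    rintro n ⟨i, h1, h2⟩ ⟨j, h3, h4⟩
    rcases pow5_tri i j with h | h | h <;> omega
  · ext n
    simp only [Set.mem_union, Set.mem_setOf_eq]
    constructor
    · rintro ((⟨j, h1, h2⟩ | ⟨j, h1, h2⟩) | ⟨j, h1, h2⟩) <;>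
        have := Nat.pow_pos (n := j) (show 0 < 5 by norm_num) <;> omega
    · intro hn
      have h1 := Nat.pow_log_le_self 5 hn.ne'
      have h2 := Nat.lt_pow_succ_log_self (b := 5) (by norm_num) n
      rw [Nat.succ_eq_add_one, pow_succ] at h2
      by_cases ha : n < 2 * 5 ^ Nat.log 5 n
      · exact Or.inl (Or.inl ⟨_, h1, ha⟩)
      by_cases hb : n < 3 * 5 ^ Nat.log 5 n
      · exact Or.inl (Or.inr ⟨_, by omega, hb⟩)
      · exact Or.inr ⟨_, not_lt.mp hb, by omega⟩
  all_goals
    refine not_dense_aux _ ?_ k hk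
    rintro a ⟨i, h1, h2⟩ b ⟨j, h3, h4⟩ ⟨h5, h6⟩
    rcases pow5_cases i j with h | h <;> omega
end

section
/- Let ω(n) denote the number of distinct prime divisors of n, and let A := {n·ω(n) : n ∈ ℕ, n ≥ 2}. Then for every integer k ≥ 2, the set D^k(A) is dense in S^{k-1}. -/
open Set Filter Topology

lemma aux_irr : Irrational (Real.log 2 / Real.log 3) := by
  rintro ⟨q, hq⟩
  have h2 : 0 < Real.log 2 := Real.log_pos (by norm_num)
  have h3 : 0 < Real.log 3 := Real.log_pos (by norm_num)
  have hqpos : 0 < q := by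
    have : (0:ℝ) < (q:ℝ) := by rw [hq]; positivity
    exact_mod_cast this
  have hnum : 0 < q.num := Rat.num_pos.mpr hqpos
  obtain ⟨p, hp⟩ := Int.eq_ofNat_of_zero_le hnum.le
  have hqq : (q:ℝ) = (p:ℝ) / (q.den:ℝ) := by
    rw [Rat.cast_def, hp]; simp
  have hd : (0:ℝ) < q.den := by exact_mod_cast q.den_pos
  have e : (q.den:ℝ) * Real.log 2 = p * Real.log 3 := by
    rw [hqq] at hq
    field_simp at hq
    linarith
  rw [← Real.log_pow, ← Real.log_pow] at e
  have e2 : (2:ℝ) ^ q.den = 3 ^ p := Real.log_injOn_pos (by simp) (by simp) e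
  have e3 : (2:ℕ) ^ q.den = 3 ^ p := by exact_mod_cast e2
  have h : 2 ∣ 3 ^ p := by rw [← e3]; exact dvd_pow_self 2 q.den_pos.ne'
  have := Nat.prime_two.dvd_of_dvd_pow h
  omega

lemma aux_gap {α β : ℝ} (ha : 0 < α) (hb : 0 < β) (hirr : Irrational (α / β)) {δ : ℝ}
    (hδ : 0 < δ) : ∃ S : ℝ, ∀ s ≥ S, ∃ a b : ℕ, s - δ < a * α + b * β ∧ a * α + b * β ≤ s := by
  have hd : Dense (AddSubgroup.closure {α, β} : Set ℝ) :=
    dense_addSubgroupClosure_pair_iff.mpr hirr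
  obtain ⟨d, ⟨hd0, hdδ⟩, hdm⟩ := hd.inter_open_nonempty (Ioo 0 δ) isOpen_Ioo ⟨δ/2, by constructor <;> linarith⟩
  rw [SetLike.mem_coe, AddSubgroup.mem_closure_pair] at hdm
  obtain ⟨m, n, hmn⟩ := hdm
  simp only [zsmul_eq_mul] at hmn
  set c := α + β with hc
  have hcpos : 0 < c := by positivity
  set J := ⌈c / d⌉₊ with hJ
  set K := J * (m.natAbs + n.natAbs) with hK
  refine ⟨K * c, fun s hs => ?_⟩
  have hs0 : 0 ≤ s := le_trans (by positivity) hs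
  set M := ⌊s / c⌋₊ with hM
  have hM1 : (M:ℝ) * c ≤ s := (le_div_iff₀ hcpos).mp (Nat.floor_le (by positivity))
  have hM2 : s < (M + 1) * c := (div_lt_iff₀ hcpos).mp (Nat.lt_floor_add_one _)
  have hKM : K ≤ M := Nat.le_floor ((le_div_iff₀ hcpos).mpr hs)
  set j := ⌊(s - M * c) / d⌋₊ with hj
  have hr0 : 0 ≤ s - M * c := by linarith
  have hj1 : (j:ℝ) * d ≤ s - M * c := (le_div_iff₀ hd0).mp (Nat.floor_le (by positivity))
  have hj2 : s - M * c < (j + 1) * d := (div_lt_iff₀ hd0).mp (Nat.lt_floor_add_one _)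
  have hjJ : j ≤ J := by
    have : (j:ℝ) ≤ J := by
      refine le_trans ?_ (Nat.le_ceil (c / d))
      rw [le_div_iff₀ hd0]
      linarith
    exact_mod_cast this
  have hjK : j * (m.natAbs + n.natAbs) ≤ M := (Nat.mul_le_mul_right _ hjJ).trans hKM
  have hjK' : (j:ℤ) * (|m| + |n|) ≤ M := by
    have := (Int.ofNat_le.mpr hjK)
    push_cast at this
    exact this
  have hm : 0 ≤ (M:ℤ) + j * m := by
    nlinarith [neg_abs_le m, abs_nonneg n, Int.natCast_nonneg j,
      mul_nonneg (Int.natCast_nonneg j) (abs_nonneg n),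
      mul_nonneg (Int.natCast_nonneg j) (by linarith [neg_abs_le m] : 0 ≤ |m| + m)]
  have hn : 0 ≤ (M:ℤ) + j * n := by
    nlinarith [neg_abs_le n, abs_nonneg m, Int.natCast_nonneg j,
      mul_nonneg (Int.natCast_nonneg j) (abs_nonneg m),
      mul_nonneg (Int.natCast_nonneg j) (by linarith [neg_abs_le n] : 0 ≤ |n| + n)]
  obtain ⟨a, ha'⟩ := Int.eq_ofNat_of_zero_le hm
  obtain ⟨b, hb'⟩ := Int.eq_ofNat_of_zero_le hn
  have ha2 : (a:ℝ) = M + j * m := by exact_mod_cast ha'.symm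
  have hb2 : (b:ℝ) = M + j * n := by exact_mod_cast hb'.symm
  have hv : (a:ℝ) * α + b * β = M * c + j * d := by
    rw [ha2, hb2, ← hmn, hc]; ring
  refine ⟨a, b, ?_, ?_⟩
  · rw [hv]; linarith
  · rw [hv]; linarith

lemma aux_mem (a b : ℕ) :
    12 * 2 ^ a * 3 ^ b ∈ {m : ℕ | ∃ n : ℕ, 2 ≤ n ∧ m = n * n.primeFactors.card} := by
  refine ⟨2 ^ (a+1) * 3 ^ (b+1), ?_, ?_⟩
  · have h1 : 1 ≤ 2 ^ a := Nat.one_le_two_pow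
    have h2 : 1 ≤ 3 ^ b := Nat.one_le_pow _ _ (by norm_num)
    have := Nat.mul_le_mul h1 h2
    rw [pow_succ, pow_succ]
    nlinarith
  · have hco : Nat.Coprime (2 ^ (a+1)) (3 ^ (b+1)) := Nat.Coprime.pow _ _ (by norm_num)
    rw [hco.primeFactors_mul, Nat.primeFactors_prime_pow (by omega) Nat.prime_two,
      Nat.primeFactors_prime_pow (by omega) Nat.prime_three]
    have : (({2} : Finset ℕ) ∪ {3}).card = 2 := by decide
    rw [this]; ring

lemma aux_one {x : ℝ} (hx : 0 ≤ x) {ε : ℝ} (hε : 0 < ε) : ∀ᶠ t : ℝ in atTop,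
    ∃ u ∈ {m : ℕ | ∃ n : ℕ, 2 ≤ n ∧ m = n * n.primeFactors.card}, |(u:ℝ) / t - x| < ε := by
  rcases hx.eq_or_lt with rfl | hx
  · filter_upwards [eventually_gt_atTop (2 / ε), eventually_gt_atTop 0] with t ht ht0
    refine ⟨2, ⟨2, le_rfl, by simp [Nat.Prime.primeFactors Nat.prime_two]⟩, ?_⟩
    rw [sub_zero, abs_of_pos (by positivity), div_lt_iff₀ ht0]
    rw [div_lt_iff₀ hε] at ht
    push_cast; linarith
  · have h2 : 0 < Real.log 2 := Real.log_pos (by norm_num)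
    have h3 : 0 < Real.log 3 := Real.log_pos (by norm_num)
    obtain ⟨S, hS⟩ := aux_gap h2 h3 aux_irr (div_pos hε hx)
    filter_upwards [eventually_ge_atTop (12 / x * Real.exp S), eventually_gt_atTop 0] with t ht ht0
    have hpos : 0 < t * x / 12 := by positivity
    have hs : S ≤ Real.log (t * x / 12) := by
      rw [Real.le_log_iff_exp_le hpos]
      rw [div_mul_eq_mul_div, div_le_iff₀ hx] at ht
      linarith
    obtain ⟨a, b, h1, h1'⟩ := hS _ hs
    refine ⟨_, aux_mem a b, ?_⟩
    have hexp : Real.exp (a * Real.log 2 + b * Real.log 3) = 2 ^ a * 3 ^ b := by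
      rw [Real.exp_add, ← Real.log_pow, ← Real.log_pow, Real.exp_log (by positivity),
        Real.exp_log (by positivity)]
    have hup : (2:ℝ) ^ a * 3 ^ b ≤ t * x / 12 := by
      rw [← hexp, ← Real.le_log_iff_exp_le hpos]; exact h1'
    have hlo : t * x / 12 * (1 - ε / x) < (2:ℝ) ^ a * 3 ^ b := by
      have e1 := Real.exp_lt_exp.mpr h1
      rw [hexp, sub_eq_add_neg, Real.exp_add, Real.exp_log hpos] at e1
      have e2 := Real.add_one_le_exp (-(ε / x))
      have := mul_le_mul_of_nonneg_left e2 hpos.le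
      linarith
    have hlo' : (t * x - t * ε) / 12 < (2:ℝ) ^ a * 3 ^ b := by
      convert hlo using 1
      field_simp
    push_cast
    have e : 12 * (2:ℝ) ^ a * 3 ^ b = 12 * (2 ^ a * 3 ^ b) := by ring
    rw [e, abs_lt]
    constructor
    · rw [neg_lt_sub_iff_lt_add, ← sub_lt_iff_lt_add', lt_div_iff₀ ht0]
      linarith
    · have : 12 * ((2:ℝ) ^ a * 3 ^ b) / t ≤ x := by
        rw [div_le_iff₀ ht0]; linarith
      linarith

lemma aux_rho {k : ℕ} (u : Fin k → ℝ) {t : ℝ} (ht : 0 < t) :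
    rho (fun i => u i / t) = rho u := by
  have : (fun i => u i / t) = t⁻¹ • u := by
    ext i; simp [div_eq_inv_mul]
  unfold rho
  rw [this, map_smul, norm_smul, smul_smul, mul_inv, Real.norm_of_nonneg (by positivity)]
  congr 1
  field_simp

/-- For A = {n·ω(n) : n ≥ 2}, where ω(n) is the number of distinct prime
divisors of n, the k-direction set D^k(A) is dense in S^{k-1} for every k ≥ 2. -/
theorem stmt_11 (k : ℕ) (hk : 2 ≤ k) :
    unitSphere k ⊆
      closure (dirSet k {m : ℕ | ∃ n : ℕ, 2 ≤ n ∧ m = n * n.primeFactors.card}) := by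
  rintro x ⟨hx1, hx2⟩
  set v : Fin k → ℝ := EuclideanSpace.equiv (Fin k) ℝ x with hv
  have hvx : (EuclideanSpace.equiv (Fin k) ℝ).symm v = x := by simp [hv]
  have hrx : rho v = x := by
    unfold rho; rw [hvx, hx1]; simp
  have hc : ContinuousAt (rho (k := k)) v := by
    unfold rho
    have h1 : ContinuousAt (fun u : Fin k → ℝ => (EuclideanSpace.equiv (Fin k) ℝ).symm u) v :=
      (EuclideanSpace.equiv (Fin k) ℝ).symm.continuous.continuousAt
    refine ContinuousAt.smul (ContinuousAt.inv₀ h1.norm ?_) h1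
    rw [hvx, hx1]; norm_num
  rw [mem_closure_iff_nhds]
  intro U hU
  rw [← hrx] at hU
  obtain ⟨ε, hε, hball⟩ := Metric.mem_nhds_iff.mp (hc hU)
  have hev := eventually_all.mpr (fun i : Fin k => aux_one (hx2 i).1 hε)
  obtain ⟨t, ht, ht0⟩ := (hev.and (eventually_gt_atTop 0)).exists
  choose u hu hu' using ht
  refine ⟨rho (fun i => (u i : ℝ)), ?_, u, hu, rfl⟩
  rw [← aux_rho (fun i => (u i : ℝ)) ht0]
  apply hball
  rw [Metric.mem_ball, dist_pi_lt_iff hε]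
  intro i
  rw [Real.dist_eq]
  exact hu' i
end
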